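/- Every local dendrite is homeomorphic to a subspace of ℝ³. -/

import Mathlib

open Topology

/-- A continuum: a nonempty compact connected metrizable topological space. -/
def IsContinuum (X : Type*) [TopologicalSpace X] : Prop :=
  Nonempty X ∧ CompactSpace X ∧ ConnectedSpace X ∧ TopologicalSpace.MetrizableSpace X

/-- A simple closed curve in `X`: a subspace homeomorphic to the circle. -/
def IsSimpleClosedCurve {X : Type*} [TopologicalSpace X] (S : Set X) : Prop :=
  Nonempty (S ≃ₜ AddCircle (1 : ℝ))

/-- A dendrite: a locally connected continuum containing no simple closed curve. -/
def IsDendrite (X : Type*) [TopologicalSpace X] : Prop :=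
  IsContinuum X ∧ LocallyConnectedSpace X ∧ ∀ S : Set X, ¬ IsSimpleClosedCurve S

/-- A local dendrite: a continuum each of whose points has a neighborhood
that is a dendrite. -/
def IsLocalDendrite (X : Type*) [TopologicalSpace X] : Prop :=
  IsContinuum X ∧ ∀ x : X, ∃ N : Set X, N ∈ 𝓝 x ∧ IsDendrite N

/-- A branch point of `X`: a point whose complement has at least three
connected components. -/
def IsBranchPoint {X : Type*} [TopologicalSpace X] (x : X) : Prop :=
  ∃ u v w : ConnectedComponents (↥({x}ᶜ : Set X)), u ≠ v ∧ u ≠ w ∧ v ≠ w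

/-- `X ∖ {x}` has countably infinitely many connected components
(i.e. there are ℵ₀ branches at `x`). -/
def HasAlephNullBranchesAt (X : Type*) [TopologicalSpace X] (x : X) : Prop :=
  Countable (ConnectedComponents (↥({x}ᶜ : Set X))) ∧
    Infinite (ConnectedComponents (↥({x}ᶜ : Set X)))

/-- Any finite family of points of an affine space of dimension `d` can be moved by less than `ε`
into general position. -/
theorem exists_generalPosition {E : Type*} [NormedAddCommGroup E] [NormedSpace ℝ E]
    [FiniteDimensional ℝ E] {ι : Type*} [Finite ι] (a : ι → E) {ε : ℝ} (hε : 0 < ε) :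
    ∃ p : ι → E, (∀ i, dist (p i) (a i) < ε) ∧
      ∀ s : Finset ι, s.card ≤ Module.finrank ℝ E + 1 →
        AffineIndependent ℝ (fun i : s => p i) := by
  classical
  cases nonempty_fintype ι
  suffices H : ∀ T : Finset ι, ∃ p : ι → E, (∀ i, dist (p i) (a i) < ε) ∧
      ∀ s ⊆ T, s.card ≤ Module.finrank ℝ E + 1 → AffineIndependent ℝ (fun i : s => p i) by
    obtain ⟨p, hp, h⟩ := H Finset.univ
    exact ⟨p, hp, fun s => h s (Finset.subset_univ s)⟩
  intro T
  induction T using Finset.induction_on with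
  | empty =>
    refine ⟨a, fun i => by simpa using hε, fun s hs _ => ?_⟩
    obtain rfl := Finset.subset_empty.1 hs
    exact affineIndependent_of_subsingleton ℝ _
  | insert j T hj ih =>
    obtain ⟨p, hp, h⟩ := ih
    borelize E
    let B : Finset (Finset ι) := T.powerset.filter fun s => s.card ≤ Module.finrank ℝ E
    have hnull : MeasureTheory.Measure.addHaar
        (⋃ s ∈ B, (affineSpan ℝ (p '' (s : Set ι)) : Set E)) = 0 := by
      refine (MeasureTheory.measure_biUnion_null_iff B.countable_toSet).2 fun s hs => ?_
      have hcard : s.card ≤ Module.finrank ℝ E := (Finset.mem_filter.1 hs).2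
      refine MeasureTheory.Measure.addHaar_affineSubspace _ _ fun htop => ?_
      have hne : s.Nonempty := by
        rw [Finset.nonempty_iff_ne_empty]
        rintro rfl
        simp at htop
      have hdim : Module.finrank ℝ (vectorSpan ℝ (p '' (s : Set ι))) = Module.finrank ℝ E := by
        rw [← direction_affineSpan, htop, AffineSubspace.direction_top, finrank_top]
      have := finrank_vectorSpan_image_finset_le ℝ p s (n := s.card - 1)
        (by have := hne.card_pos; omega)
      rw [Finset.coe_image] at this
      have := hne.card_pos
      omega
    obtain ⟨q, hq, hqB⟩ : ∃ q ∈ Metric.ball (a j) ε,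
        q ∉ ⋃ s ∈ B, (affineSpan ℝ (p '' (s : Set ι)) : Set E) := by
      by_contra! hcon
      have := MeasureTheory.measure_mono_null (μ := MeasureTheory.Measure.addHaar) hcon hnull
      exact (Metric.measure_ball_pos _ (a j) hε).ne' this
    refine ⟨Function.update p j q, fun i => ?_, fun s hs hcard => ?_⟩
    · rcases eq_or_ne i j with rfl | hij
      · simpa using hq
      · simpa [hij] using hp i
    · have hsT : s.erase j ⊆ T := by
        intro i hi
        have := hs (Finset.mem_of_mem_erase hi)
        exact (Finset.mem_insert.1 this).resolve_left (Finset.ne_of_mem_erase hi)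
      by_cases hjs : j ∈ s
      · have hcard' : (s.erase j).card ≤ Module.finrank ℝ E := by
          rw [Finset.card_erase_of_mem hjs]; omega
        refine AffineIndependent.affineIndependent_of_notMem_span (i := ⟨j, hjs⟩) ?_ ?_
        · let e : {y : s // y ≠ ⟨j, hjs⟩} ↪ (s.erase j : Finset ι) :=
            ⟨fun y => ⟨y.1.1, Finset.mem_erase.2 ⟨fun h => y.2 (Subtype.ext h), y.1.2⟩⟩,
              fun y z hyz => Subtype.ext (Subtype.ext
                (congrArg (fun t : (s.erase j : Finset ι) => (t : ι)) hyz))⟩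
          have := (h (s.erase j) hsT (hcard'.trans (Nat.le_succ _))).comp_embedding e
          have heq : (fun i : s.erase j => p i) ∘ e = fun y => Function.update p j q y.1.1 := by
            funext y
            have : (y.1.1 : ι) ≠ j := fun h => y.2 (Subtype.ext h)
            exact (Function.update_of_ne this _ _).symm
          exact Eq.subst (motive := fun F => AffineIndependent ℝ F) heq this
        · intro hmem
          apply hqB
          simp only [Set.mem_iUnion]
          refine ⟨s.erase j, Finset.mem_filter.2 ⟨Finset.mem_powerset.2 hsT, hcard'⟩, ?_⟩
          simp only [Function.update_self] at hmem
          refine affineSpan_mono ℝ ?_ hmem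
          rintro _ ⟨y, hy, rfl⟩
          have : (y.1 : ι) ≠ j := fun h => hy (Subtype.ext h)
          exact ⟨y.1, by simp [this], by simp [this]⟩
      · rw [Finset.erase_eq_of_notMem hjs] at hsT
        convert h s hsT hcard using 1
        funext i
        have : (i : ι) ≠ j := fun h => hjs (h ▸ i.2)
        simp [this]

/-- A map into a finite-dimensional space can be approximated by a map with small fibres, provided
the source has fine finite open covers of small order. -/
theorem exists_dist_lt_of_small_fibers {X : Type*} [MetricSpace X] [CompactSpace X]
    {E : Type*} [NormedAddCommGroup E] [NormedSpace ℝ E] [FiniteDimensional ℝ E] {n : ℕ}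
    (hn : 2 * n ≤ Module.finrank ℝ E + 1) {ε : ℝ}
    (hcov : ∀ δ > 0, ∃ (ι : Type*) (_ : Finite ι) (U : ι → Set X), (∀ i, IsOpen (U i)) ∧
      (⋃ i, U i) = Set.univ ∧ (∀ i, ∀ x ∈ U i, ∀ y ∈ U i, dist x y < δ) ∧
      ∀ x, {i | x ∈ U i}.ncard ≤ n)
    (hε : 0 < ε) (f : C(X, E)) {r : ℝ} (hr : 0 < r) :
    ∃ g : C(X, E), dist g f < r ∧ ∀ x y, g x = g y → dist x y < ε := by
  classical
  obtain ⟨δ, hδ, hfδ⟩ := Metric.uniformContinuous_iff.1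
    (CompactSpace.uniformContinuous_of_continuous f.continuous) (r / 4) (by positivity)
  obtain ⟨ι, _, U, hUo, hUc, hUδ, hUn⟩ := hcov (min δ ε) (lt_min hδ hε)
  cases nonempty_fintype ι
  have hbase : ∀ i, ∃ a : E, ∀ x ∈ U i, dist a (f x) < r / 4 := by
    intro i
    rcases (U i).eq_empty_or_nonempty with h | ⟨z, hz⟩
    · exact ⟨0, by simp [h]⟩
    · exact ⟨f z, fun x hx => hfδ ((hUδ i z hz x hx).trans_le (min_le_left _ _))⟩
  choose a ha using hbase
  obtain ⟨p, hpa, hp⟩ := exists_generalPosition a (ε := r / 4) (by positivity)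
  obtain ⟨φ, hφ⟩ := PartitionOfUnity.exists_isSubordinate (s := (Set.univ : Set X)) isClosed_univ U
    hUo (by rw [hUc])
  have hφU : ∀ {i x}, φ i x ≠ 0 → x ∈ U i := fun {i x} h => hφ i (subset_tsupport _ h)
  have hsum : ∀ x, ∑ i, φ i x = 1 := fun x => by
    rw [← finsum_eq_sum_of_fintype]; exact φ.sum_eq_one (Set.mem_univ x)
  let g : C(X, E) := ⟨fun x => ∑ i, φ i x • p i, by fun_prop⟩
  refine ⟨g, ?_, fun x y hxy => ?_⟩
  · refine lt_of_le_of_lt ((ContinuousMap.dist_le (by positivity : 0 ≤ r / 2)).2 fun x => ?_)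
      (half_lt_self hr)
    have hgf : g x - f x = ∑ i, φ i x • (p i - f x) := by
      simp [g, smul_sub, Finset.sum_sub_distrib, ← Finset.sum_smul, hsum]
    rw [dist_eq_norm, hgf]
    calc ‖∑ i, φ i x • (p i - f x)‖ ≤ ∑ i, φ i x * (r / 2) := by
          refine norm_sum_le_of_le _ fun i _ => ?_
          rw [norm_smul, Real.norm_of_nonneg (φ.nonneg i x)]
          by_cases h : φ i x = 0
          · simp [h]
          · refine mul_le_mul_of_nonneg_left ?_ (φ.nonneg i x)
            rw [← dist_eq_norm]
            have h1 := hpa i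
            have h2 := ha i x (hφU h)
            have h3 := dist_triangle (p i) (a i) (f x)
            linarith
      _ = r / 2 := by rw [← Finset.sum_mul, hsum, one_mul]
  · let s : Finset ι := Finset.univ.filter fun i => x ∈ U i ∨ y ∈ U i
    have hs : s.card ≤ Module.finrank ℝ E + 1 := by
      have h1 := hUn x
      have h2 := hUn y
      rw [Set.ncard_eq_toFinset_card'] at h1 h2
      refine le_trans ?_ hn
      refine (Finset.card_le_card (t := {i | x ∈ U i}.toFinset ∪ {i | y ∈ U i}.toFinset) ?_).trans
        ((Finset.card_union_le _ _).trans (by omega))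
      intro i
      simp [s]
    have hsupp : ∀ i ∉ s, φ i x - φ i y = 0 := by
      intro i hi
      have hx : φ i x = 0 := by
        by_contra h; exact hi (by simp [s, hφU h])
      have hy : φ i y = 0 := by
        by_contra h; exact hi (by simp [s, hφU h])
      rw [hx, hy, sub_zero]
    have hw := (affineIndependent_iff.1 (hp s hs)) Finset.univ (fun i => φ i x - φ i y)
      (by
        rw [Finset.sum_coe_sort s (fun i => φ i x - φ i y),
          Finset.sum_subset (Finset.subset_univ s) fun i _ hi => hsupp i hi]
        simp [Finset.sum_sub_distrib, hsum])
      (by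
        rw [Finset.sum_coe_sort s (fun i => (φ i x - φ i y) • p i),
          Finset.sum_subset (Finset.subset_univ s) fun i _ hi => by rw [hsupp i hi, zero_smul]]
        have : ∑ i, φ i x • p i = ∑ i, φ i y • p i := hxy
        simp [sub_smul, Finset.sum_sub_distrib, this])
    obtain ⟨i, hi⟩ : ∃ i, φ i x ≠ 0 := by
      by_contra! h
      simpa [h] using hsum x
    have hix := hφU hi
    have his : i ∈ s := by simp [s, hix]
    have hiy : φ i y ≠ 0 := by
      have : φ i x - φ i y = 0 := hw ⟨i, his⟩ (Finset.mem_univ _)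
      rwa [← sub_eq_zero.1 this]
    exact (hUδ i x hix y (hφU hiy)).trans_le (min_le_right _ _)

/-- Maps with fibres of diameter less than `ε` form an open set. -/
theorem isOpen_setOf_small_fibers {X E : Type*} [MetricSpace X] [CompactSpace X] [MetricSpace E]
    (ε : ℝ) : IsOpen {f : C(X, E) | ∀ x y, f x = f y → dist x y < ε} := by
  rw [Metric.isOpen_iff]
  intro f hf
  let K : Set (X × X) := {z | ε ≤ dist z.1 z.2}
  have hK : IsCompact K := (isClosed_le continuous_const continuous_dist).isCompact
  rcases K.eq_empty_or_nonempty with hE | hne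
  · refine ⟨1, one_pos, fun g _ x y _ => ?_⟩
    by_contra! h
    exact (hE ▸ (show (x, y) ∈ K from h) : (x, y) ∈ (∅ : Set (X × X)))
  · obtain ⟨z, hz, hmin⟩ := hK.exists_isMinOn hne
      (f := fun z => dist (f z.1) (f z.2)) (by fun_prop)
    have hpos : 0 < dist (f z.1) (f z.2) := by
      rw [dist_pos]
      intro h
      exact (hf _ _ h).not_ge hz
    refine ⟨dist (f z.1) (f z.2) / 2, by positivity, fun g hg x y hxy => ?_⟩
    by_contra! h
    have h1 : dist (f z.1) (f z.2) ≤ dist (f x) (f y) := hmin (show (x, y) ∈ K from h)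
    have h2 := ContinuousMap.dist_apply_le_dist (f := g) (g := f) x
    have h3 := ContinuousMap.dist_apply_le_dist (f := g) (g := f) y
    have h4 := dist_triangle4 (f x) (g x) (g y) (f y)
    rw [hxy, dist_self, ← hxy, dist_comm (f x) (g x), hxy] at h4
    rw [Metric.mem_ball] at hg
    rw [hxy] at h2
    linarith

/-- **Menger–Nöbeling embedding theorem**, for a compact metric space having arbitrarily fine finite
open covers of order at most `n`. -/
theorem exists_isEmbedding_of_covers {X : Type*} [MetricSpace X] [CompactSpace X]
    {E : Type*} [NormedAddCommGroup E] [NormedSpace ℝ E] [FiniteDimensional ℝ E] {n : ℕ}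
    (hn : 2 * n ≤ Module.finrank ℝ E + 1)
    (hcov : ∀ δ > 0, ∃ (ι : Type*) (_ : Finite ι) (U : ι → Set X), (∀ i, IsOpen (U i)) ∧
      (⋃ i, U i) = Set.univ ∧ (∀ i, ∀ x ∈ U i, ∀ y ∈ U i, dist x y < δ) ∧
      ∀ x, {i | x ∈ U i}.ncard ≤ n) :
    ∃ f : X → E, IsEmbedding f := by
  have : CompleteSpace E := FiniteDimensional.complete ℝ E
  have hdense := dense_iInter_of_isOpen_nat
    (f := fun k : ℕ => {f : C(X, E) | ∀ x y, f x = f y → dist x y < 1 / ((k : ℝ) + 1)})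
    (fun k => isOpen_setOf_small_fibers _)
    (fun k f => Metric.mem_closure_iff.2 fun r hr => by
      obtain ⟨g, hg, hg'⟩ := exists_dist_lt_of_small_fibers hn hcov
        (Nat.one_div_pos_of_nat (n := k)) f hr
      exact ⟨g, hg', by rwa [dist_comm]⟩)
  obtain ⟨f, hf⟩ := hdense.nonempty
  rw [Set.mem_iInter] at hf
  refine ⟨f, (f.continuous.isClosedEmbedding fun x y hxy => ?_).isEmbedding⟩
  by_contra hne
  obtain ⟨k, hk⟩ := exists_nat_one_div_lt (dist_pos.2 hne)
  exact lt_asymm hk (hf k x y hxy)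

/-- A compact metric space with a base of open sets with finite frontier has arbitrarily fine finite
open covers of order at most two. -/
theorem exists_cover_order_two.{v} {X : Type v} [MetricSpace X] [CompactSpace X]
    (hreg : ∀ x : X, ∀ W ∈ 𝓝 x, ∃ V ⊆ W, IsOpen V ∧ x ∈ V ∧ (frontier V).Finite)
    {δ : ℝ} (hδ : 0 < δ) :
    ∃ (ι : Type v) (_ : Finite ι) (U : ι → Set X), (∀ i, IsOpen (U i)) ∧
      (⋃ i, U i) = Set.univ ∧ (∀ i, ∀ x ∈ U i, ∀ y ∈ U i, dist x y < δ) ∧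
      ∀ x, {i | x ∈ U i}.ncard ≤ 2 := by
  classical
  choose V hVW hVo hxV hVf using fun x : X =>
    hreg x (Metric.ball x (δ / 2)) (Metric.ball_mem_nhds x (by positivity))
  obtain ⟨t, ht⟩ := isCompact_univ.elim_finite_subcover V hVo
    fun x _ => Set.mem_iUnion.2 ⟨x, hxV x⟩
  have hball : ∀ {z x y : X}, x ∈ Metric.ball z (δ / 2) → y ∈ Metric.ball z (δ / 2) →
      dist x y < δ := fun {z x y} hx hy => by
    have := dist_triangle_right x y z
    rw [Metric.mem_ball] at hx hy
    linarith
  let F : Set X := ⋃ i ∈ t, frontier (V i)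
  have hF : F.Finite := t.finite_toSet.biUnion fun i _ => hVf i
  obtain ⟨B, hB, hBd⟩ := hF.t2_separation
  let e := t.equivFin
  let D : t → Set X := fun i => V i \ ⋃ j ∈ {j : t | e j < e i}, closure (V j)
  have hDo : ∀ i, IsOpen (D i) := fun i =>
    (hVo i).sdiff ((Set.toFinite _).isClosed_biUnion fun j _ => isClosed_closure)
  have hDd : ∀ {i j x}, x ∈ D i → x ∈ D j → ¬ e i < e j := fun {i j x} hi hj hlt =>
    hj.2 (Set.mem_biUnion hlt (subset_closure hi.1))
  have hDF : ∀ x ∉ F, ∃ i, x ∈ D i := by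
    intro x hx
    obtain ⟨i₀, hi₀t, hi₀⟩ := Set.mem_iUnion₂.1 (ht (Set.mem_univ x))
    have hne : {i : t | x ∈ V i}.Nonempty := ⟨⟨i₀, hi₀t⟩, hi₀⟩
    obtain ⟨i, hi, hmin⟩ := Set.exists_min_image _ e (Set.toFinite _) hne
    refine ⟨i, hi, fun hmem => ?_⟩
    obtain ⟨j, hj, hxj⟩ := Set.mem_iUnion₂.1 hmem
    have hxVj : x ∉ V j := fun h => (hmin j h).not_gt hj
    exact hx (Set.mem_biUnion j.2 ⟨hxj, by rwa [(hVo j).interior_eq]⟩)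
  have : Finite F := hF
  refine ⟨t ⊕ F, inferInstance, Sum.elim D fun z => B z ∩ Metric.ball z (δ / 2), ?_, ?_, ?_, ?_⟩
  · rintro (i | z)
    · exact hDo i
    · exact (hB z).2.inter Metric.isOpen_ball
  · refine Set.eq_univ_of_forall fun x => Set.mem_iUnion.2 ?_
    by_cases hx : x ∈ F
    · exact ⟨Sum.inr ⟨x, hx⟩, (hB x).1, Metric.mem_ball_self (by positivity)⟩
    · obtain ⟨i, hi⟩ := hDF x hx
      exact ⟨Sum.inl i, hi⟩
  · rintro (i | z) x hx y hy
    · exact hball (hVW _ hx.1) (hVW _ hy.1)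
    · exact hball hx.2 hy.2
  · intro x
    have hsub : {i | x ∈ Sum.elim D (fun z : F => B z ∩ Metric.ball z (δ / 2)) i} =
        Sum.inl '' {i | x ∈ D i} ∪ Sum.inr '' {z : F | x ∈ B z ∩ Metric.ball z (δ / 2)} := by
      ext (i | z) <;> simp
    rw [hsub]
    refine (Set.ncard_union_le _ _).trans (Nat.add_le_add (b := 1) (d := 1) ?_ ?_)
    · refine (Set.ncard_image_le (Set.toFinite _)).trans ((Set.ncard_le_one_iff (Set.toFinite _)).2 ?_)
      intro i j hi hj
      exact e.injective (le_antisymm (not_lt.1 (hDd hj hi)) (not_lt.1 (hDd hi hj)))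
    · refine (Set.ncard_image_le (Set.toFinite _)).trans ((Set.ncard_le_one_iff (Set.toFinite _)).2 ?_)
      intro z w hz hw
      by_contra hne
      exact Set.disjoint_left.1 (hBd z.2 w.2 fun h => hne (Subtype.ext h)) hz.1 hw.1

/-- Having arbitrarily small open neighbourhoods with finite frontier is a local property. -/
theorem exists_isOpen_finite_frontier_of_mem_nhds {X : Type*} [TopologicalSpace X] {N : Set X}
    (hN : IsClosed N) {x : X} (hx : N ∈ 𝓝 x)
    (hreg : ∀ y : N, ∀ W ∈ 𝓝 y, ∃ V ⊆ W, IsOpen V ∧ y ∈ V ∧ (frontier V).Finite)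
    {W : Set X} (hW : W ∈ 𝓝 x) :
    ∃ V ⊆ W, IsOpen V ∧ x ∈ V ∧ (frontier V).Finite := by
  obtain ⟨V, hVW, hVo, hxV, hVf⟩ := hreg ⟨x, mem_of_mem_nhds hx⟩
    ((↑) ⁻¹' (W ∩ interior N)) (continuous_subtype_val.continuousAt.preimage_mem_nhds
      (Filter.inter_mem hW (interior_mem_nhds.2 hx)))
  have hVo' : IsOpen (((↑) : N → X) '' V) := by
    obtain ⟨O, hO, rfl⟩ := isOpen_induced_iff.1 hVo
    have : ((↑) : N → X) '' ((↑) ⁻¹' O) = O ∩ interior N := by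
      ext y
      constructor
      · rintro ⟨z, hz, rfl⟩
        exact ⟨hz, (hVW hz).2⟩
      · rintro ⟨hy, hyN⟩
        exact ⟨⟨y, interior_subset hyN⟩, hy, rfl⟩
    rw [this]
    exact hO.inter isOpen_interior
  refine ⟨(↑) '' V, ?_, hVo', ⟨_, hxV, rfl⟩, ?_⟩
  · rintro _ ⟨z, hz, rfl⟩
    exact (hVW hz).1
  · rw [hVo'.frontier_eq, hN.isClosedEmbedding_subtypeVal.closure_image_eq,
      ← Set.image_sdiff Subtype.val_injective, ← hVo.frontier_eq]
    exact hVf.image _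

/-- If any two points of a compact metrizable space can be separated by a third one, then the open
sets with finite frontier form a base. -/
theorem exists_isOpen_finite_frontier_of_separation {X : Type*} [TopologicalSpace X]
    [CompactSpace X] [T2Space X]
    (hsep : ∀ x y : X, x ≠ y → ∃ (z : X) (A : Set X), IsOpen A ∧ x ∈ A ∧ y ∉ closure A ∧
      frontier A ⊆ {z})
    (x : X) {W : Set X} (hW : W ∈ 𝓝 x) :
    ∃ V ⊆ W, IsOpen V ∧ x ∈ V ∧ (frontier V).Finite := by
  wlog hWo : IsOpen W generalizing W
  · obtain ⟨V, hV, h⟩ := this (interior_mem_nhds.2 hW) isOpen_interior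
    exact ⟨V, hV.trans interior_subset, h⟩
  choose! z A hAo hxA hyA hfr using hsep x
  have hK : IsCompact (frontier W) := isClosed_frontier.isCompact
  have hxne : ∀ y ∈ frontier W, x ≠ y := by
    rintro y hy rfl
    rw [hWo.frontier_eq] at hy
    exact hy.2 (mem_of_mem_nhds hW)
  obtain ⟨t, htK, ht⟩ := hK.elim_nhds_subcover (fun y => (closure (A y))ᶜ)
    fun y hy => isClosed_closure.isOpen_compl.mem_nhds (hyA y (hxne y hy))
  refine ⟨W ∩ ⋂ y ∈ t, A y, Set.inter_subset_left,
    hWo.inter (isOpen_biInter_finset fun y hy => hAo y (hxne y (htK y hy))),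
    ⟨mem_of_mem_nhds hW, Set.mem_iInter₂.2 fun y hy => hxA y (hxne y (htK y hy))⟩, ?_⟩
  refine (t.finite_toSet.image z).subset fun w hw => ?_
  have hcl : w ∈ closure W ∧ ∀ y ∈ t, w ∈ closure (A y) :=
    ⟨closure_mono Set.inter_subset_left hw.1, fun y hy =>
      closure_mono (Set.inter_subset_right.trans (Set.biInter_subset_of_mem hy)) hw.1⟩
  have hwW : w ∈ W := by
    by_contra hwW
    obtain ⟨y, hy, hwy⟩ := Set.mem_iUnion₂.1 (ht (by rw [hWo.frontier_eq]; exact ⟨hcl.1, hwW⟩))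
    exact hwy (hcl.2 y hy)
  by_contra! hwz
  refine hw.2 (mem_interior.2 ⟨_, subset_rfl,
    hWo.inter (isOpen_biInter_finset fun y hy => hAo y (hxne y (htK y hy))), hwW,
    Set.mem_iInter₂.2 fun y hy => ?_⟩)
  by_contra hwA
  have hwf : w ∈ frontier (A y) := by
    rw [(hAo y (hxne y (htK y hy))).frontier_eq]
    exact ⟨hcl.2 y hy, hwA⟩
  exact hwz ⟨y, hy, (hfr y (hxne y (htK y hy)) hwf).symm⟩

/-- Two points are `ε`-linked if they lie in a common connected set of diameter at most `ε`. -/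
def Linked {X : Type*} [MetricSpace X] (ε : ℝ) (x y : X) : Prop :=
  ∃ C : Set X, IsPreconnected C ∧ x ∈ C ∧ y ∈ C ∧ ∀ a ∈ C, ∀ b ∈ C, dist a b ≤ ε

theorem Linked.refl {X : Type*} [MetricSpace X] {ε : ℝ} (hε : 0 ≤ ε) (x : X) : Linked ε x x :=
  ⟨{x}, isPreconnected_singleton, rfl, rfl, by rintro _ rfl _ rfl; simpa using hε⟩

theorem Linked.symm {X : Type*} [MetricSpace X] {ε : ℝ} {x y : X} (h : Linked ε x y) :
    Linked ε y x :=
  let ⟨C, hC, hx, hy, h⟩ := h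
  ⟨C, hC, hy, hx, h⟩

theorem Linked.dist_le {X : Type*} [MetricSpace X] {ε : ℝ} {x y : X} (h : Linked ε x y) :
    dist x y ≤ ε :=
  let ⟨_, _, hx, hy, h⟩ := h
  h _ hx _ hy

theorem eventually_linked {X : Type*} [MetricSpace X] [LocallyConnectedSpace X] {ε : ℝ}
    (hε : 0 < ε) (x : X) : ∀ᶠ y in 𝓝 x, Linked ε x y := by
  obtain ⟨V, hV, hVo, hxV, hVc⟩ := locallyConnectedSpace_iff_subsets_isOpen_isConnected.1
    ‹_› x _ (Metric.ball_mem_nhds x (half_pos hε))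
  filter_upwards [hVo.mem_nhds hxV] with y hy
  refine ⟨V, hVc.isPreconnected, hxV, hy, fun a ha b hb => ?_⟩
  have h1 := hV ha
  have h2 := hV hb
  have := dist_triangle_right a b x
  rw [Metric.mem_ball] at h1 h2
  linarith

/-- Points of a connected set in a locally connected space are joined by a chain of arbitrarily
close links. -/
theorem IsPreconnected.exists_linked_chain {X : Type*} [MetricSpace X] [LocallyConnectedSpace X]
    {C : Set X} (hC : IsPreconnected C) {ε : ℝ} (hε : 0 < ε) {x y : X} (hx : x ∈ C) (hy : y ∈ C) :
    ∃ (k : ℕ) (c : ℕ → X), c 0 = x ∧ (∀ i, k ≤ i → c i = y) ∧ (∀ i, c i ∈ C) ∧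
      ∀ i, Linked ε (c i) (c (i + 1)) := by
  refine hC.induction₂ (fun x y => ∃ (k : ℕ) (c : ℕ → X), c 0 = x ∧ (∀ i, k ≤ i → c i = y) ∧
    (∀ i, c i ∈ C) ∧ ∀ i, Linked ε (c i) (c (i + 1))) ?_ ?_ ?_ hx hy
  · intro x hx
    filter_upwards [mem_nhdsWithin_of_mem_nhds (eventually_linked hε x), self_mem_nhdsWithin]
      with y hxy hy
    refine ⟨1, fun i => if i = 0 then x else y, by simp, fun i hi => ?_, fun i => ?_, fun i => ?_⟩
    · simp [show i ≠ 0 by omega]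
    · dsimp only; split_ifs <;> assumption
    · by_cases h : i = 0
      · simpa [h] using hxy
      · simpa [h] using Linked.refl hε.le y
  · rintro x y z - - - ⟨k, c, hc0, hck, hcC, hcl⟩ ⟨l, d, hd0, hdl, hdC, hdl'⟩
    refine ⟨k + l, fun i => if i < k then c i else d (i - k), ?_, fun i hi => ?_, fun i => ?_,
      fun i => ?_⟩
    · by_cases h : 0 < k
      · simpa [h] using hc0
      · obtain rfl : k = 0 := by omega
        simpa [hd0] using (hck 0 le_rfl).symm.trans hc0
    · simpa [show ¬ i < k by omega] using hdl (i - k) (by omega)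
    · dsimp only; split_ifs
      exacts [hcC i, hdC _]
    · rcases lt_trichotomy (i + 1) k with h | h | h
      · simpa [h, show i < k by omega] using hcl i
      · have := hcl i
        rw [hck (i + 1) h.ge, ← hd0] at this
        simpa [h, show i < k by omega] using this
      · have := hdl' (i - k)
        rw [show i - k + 1 = i + 1 - k by omega] at this
        simpa [show ¬ i < k by omega, show ¬ i + 1 < k by omega] using this
  · rintro x y - - ⟨k, c, hc0, hck, hcC, hcl⟩
    refine ⟨k, fun i => c (k - i), hck _ (by simp), fun i hi => ?_, fun i => hcC _, fun i => ?_⟩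
    · simpa [show k - i = 0 by omega] using hc0
    · by_cases h : i < k
      · have := hcl (k - (i + 1))
        rw [show k - (i + 1) + 1 = k - i by omega] at this
        exact this.symm
      · simpa [show k - i = 0 by omega, show k - (i + 1) = 0 by omega] using Linked.refl hε.le (c 0)

/-- A finite chain of links can be subdivided into a finer one. -/
theorem exists_linked_chain_refinement {X : Type*} [MetricSpace X] [LocallyConnectedSpace X]
    {ε ε' : ℝ} (hε' : 0 < ε') (K : ℕ) (c : ℕ → X) (hc : ∀ i < K, Linked ε (c i) (c (i + 1))) :
    ∃ k, 0 < k ∧ ∃ d : ℕ → X, (∀ i ≤ K, d (i * k) = c i) ∧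
      (∀ i < K * k, Linked ε' (d i) (d (i + 1))) ∧ ∀ i < K * k, dist (d i) (c (i / k)) ≤ ε := by
  have H : ∀ i < K, ∃ (l : ℕ) (e : ℕ → X), e 0 = c i ∧ (∀ j, l ≤ j → e j = c (i + 1)) ∧
      (∀ j, Linked ε' (e j) (e (j + 1))) ∧ ∀ j, dist (e j) (c i) ≤ ε := by
    intro i hi
    obtain ⟨C, hC, h0, h1, hd⟩ := hc i hi
    obtain ⟨l, e, he0, hel, heC, he⟩ := hC.exists_linked_chain hε' h0 h1
    exact ⟨l, e, he0, hel, he, fun j => hd _ (heC j) _ h0⟩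
  have : Nonempty X := ⟨c 0⟩
  choose! l e he0 hel he hed using H
  obtain ⟨k, hk⟩ : ∃ k, ∀ i < K, l i ≤ k :=
    ⟨(Finset.range K).sup l, fun i hi => Finset.le_sup (f := l) (Finset.mem_range.2 hi)⟩
  have hk0 : 0 < k + 1 := Nat.succ_pos k
  have hdiv : ∀ {i}, i < K * (k + 1) → i / (k + 1) < K := fun h => (Nat.div_lt_iff_lt_mul hk0).2 h
  refine ⟨k + 1, hk0, fun i => if i / (k + 1) < K then e (i / (k + 1)) (i % (k + 1)) else c K,
    fun i hi => ?_, fun i hi => ?_, fun i hi => ?_⟩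
  · rcases hi.lt_or_eq with h | h
    · simp [h, he0 i h]
    · simp [h]
  · rcases (Nat.succ_le_iff.2 (Nat.mod_lt i hk0)).lt_or_eq with h | h
    · obtain ⟨h1, h2⟩ : (i + 1) / (k + 1) = i / (k + 1) ∧ (i + 1) % (k + 1) = i % (k + 1) + 1 := by
        refine (Nat.div_mod_unique hk0).2 ⟨?_, h⟩
        have := Nat.mod_add_div i (k + 1)
        omega
      simpa [h1, h2, hdiv hi] using he _ (hdiv hi) (i % (k + 1))
    · obtain ⟨h1, h2⟩ : (i + 1) / (k + 1) = i / (k + 1) + 1 ∧ (i + 1) % (k + 1) = 0 := by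
        refine (Nat.div_mod_unique hk0).2 ⟨?_, hk0⟩
        have := Nat.mod_add_div i (k + 1)
        rw [mul_add]
        omega
      have := he _ (hdiv hi) (i % (k + 1))
      rw [show i % (k + 1) + 1 = k + 1 from h,
        hel _ (hdiv hi) (k + 1) ((hk _ (hdiv hi)).trans (Nat.le_succ k))] at this
      simp only [hdiv hi, if_true, h1, h2]
      split_ifs with h3
      · rwa [he0 _ h3]
      · rwa [show K = i / (k + 1) + 1 by have := hdiv hi; omega]
  · simpa [hdiv hi] using hed _ (hdiv hi) (i % (k + 1))

/-- In a complete locally connected metric space, linked points are joined by a small path. -/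
theorem Linked.exists_path {X : Type*} [MetricSpace X] [CompleteSpace X] [LocallyConnectedSpace X]
    {ε : ℝ} (hε : 0 < ε) {x y : X} (hxy : Linked ε x y) :
    ∃ γ : Path x y, ∀ t, dist (γ t) x ≤ 3 * ε := by
  let P : ℕ → ℕ × (ℕ → X) → Prop := fun n s => 0 < s.1 ∧ s.2 0 = x ∧ s.2 s.1 = y ∧
    ∀ i < s.1, Linked (ε / 2 ^ n) (s.2 i) (s.2 (i + 1))
  let Q : ℕ → ℕ × (ℕ → X) → ℕ × (ℕ → X) → Prop := fun n s s' => ∃ k, 0 < k ∧ s'.1 = s.1 * k ∧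
    ∀ i < s.1 * k, dist (s'.2 i) (s.2 (i / k)) ≤ ε / 2 ^ n
  have step : ∀ n s, P n s → ∃ s', P (n + 1) s' ∧ Q n s s' := by
    rintro n ⟨K, c⟩ ⟨hK, h0, h1, hc⟩
    dsimp only at hK h0 h1 hc
    obtain ⟨k, hk, d, hdc, hdl, hdd⟩ := exists_linked_chain_refinement
      (show 0 < ε / 2 ^ (n + 1) by positivity) K c hc
    exact ⟨(K * k, d), ⟨Nat.mul_pos hK hk, by simpa [h0] using hdc 0 (Nat.zero_le _),
      (hdc K le_rfl).trans h1, hdl⟩, k, hk, rfl, hdd⟩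
  have hP0 : P 0 (1, fun i => if i = 0 then x else y) :=
    ⟨one_pos, by simp, by simp, fun i hi => by
      obtain rfl : i = 0 := Nat.lt_one_iff.1 hi
      simpa using hxy⟩
  choose! next hnext hQ using step
  let s : ℕ → ℕ × (ℕ → X) := fun n => Nat.rec (1, fun i => if i = 0 then x else y) next n
  have hs : ∀ n, P n (s n) := fun n => by
    induction n with
    | zero => exact hP0
    | succ n ih => exact hnext n _ ih
  have hsQ : ∀ n, Q n (s n) (s (n + 1)) := fun n => hQ n _ (hs n)
  let f : ℕ → unitInterval → X := fun n t => (s n).2 ⌊((s n).1 : ℝ) * t⌋₊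
  have hf0 : ∀ n, f n 0 = x := fun n => by simpa [f] using (hs n).2.1
  have hf1 : ∀ n, f n 1 = y := fun n => by simpa [f] using (hs n).2.2.1
  have hfloor : ∀ n (t : unitInterval), t ≠ 1 → ⌊((s n).1 : ℝ) * t⌋₊ < (s n).1 := by
    intro n t ht
    have hpos : (0 : ℝ) < (s n).1 := Nat.cast_pos.2 (hs n).1
    rw [Nat.floor_lt (mul_nonneg hpos.le t.2.1)]
    exact mul_lt_of_lt_one_right hpos (lt_of_le_of_ne t.2.2 fun h => ht (Subtype.ext h))
  have hstep : ∀ t n, dist (f n t) (f (n + 1) t) ≤ 2 * ε / 2 / 2 ^ n := by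
    intro t n
    rw [mul_div_cancel_left₀ _ (two_ne_zero' ℝ)]
    by_cases ht : t = 1
    · simp only [ht, hf1, dist_self]
      positivity
    · obtain ⟨k, hk, hK, hd⟩ := hsQ n
      have hlt := hfloor (n + 1) t ht
      rw [hK] at hlt
      have := hd _ hlt
      rw [dist_comm]
      convert this using 3
      · simp only [f, hK]
      · simp only [f]
        rw [← Nat.floor_div_natCast]
        have : (k : ℝ) ≠ 0 := by positivity
        push_cast
        field_simp
  have hlim : ∀ t, ∃ z, Filter.Tendsto (fun n => f n t) Filter.atTop (𝓝 z) := fun t =>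
    cauchySeq_tendsto_of_complete (cauchySeq_of_le_geometric_two (hstep t))
  choose γ hγ using hlim
  have hγd : ∀ t n, dist (f n t) (γ t) ≤ 2 * ε / 2 ^ n := fun t n =>
    dist_le_of_le_geometric_two_of_tendsto (hstep t) (hγ t) n
  have hclose : ∀ n (t u : unitInterval), ((s n).1 : ℝ) * dist t u < 1 →
      dist (f n t) (f n u) ≤ ε / 2 ^ n := by
    intro n t u htu
    wlog hle : t ≤ u generalizing t u
    · rw [dist_comm]
      exact this u t (by rwa [dist_comm]) (le_of_not_ge hle)
    have hK : (0 : ℝ) ≤ (s n).1 := Nat.cast_nonneg _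
    have h1 : ⌊((s n).1 : ℝ) * t⌋₊ ≤ ⌊((s n).1 : ℝ) * u⌋₊ :=
      Nat.floor_le_floor (mul_le_mul_of_nonneg_left hle hK)
    have h2 : ⌊((s n).1 : ℝ) * u⌋₊ ≤ ⌊((s n).1 : ℝ) * t⌋₊ + 1 := by
      rw [← Nat.floor_add_one (mul_nonneg hK t.2.1)]
      refine Nat.floor_le_floor ?_
      rw [Subtype.dist_eq, Real.dist_eq, abs_sub_comm,
        abs_of_nonneg (sub_nonneg.2 (show (t : ℝ) ≤ u from hle)),
        mul_sub] at htu
      linarith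
    rcases h1.eq_or_lt with h | h
    · simp only [f, h, dist_self]
      positivity
    · have h3 : ⌊((s n).1 : ℝ) * u⌋₊ = ⌊((s n).1 : ℝ) * t⌋₊ + 1 := by omega
      have h4 : ⌊((s n).1 : ℝ) * u⌋₊ ≤ (s n).1 := by
        refine Nat.floor_le_of_le ?_
        exact mul_le_of_le_one_right hK u.2.2
      simp only [f, h3]
      exact ((hs n).2.2.2 _ (by omega)).dist_le
  have hcont : Continuous γ := by
    rw [Metric.continuous_iff]
    intro t η hη
    obtain ⟨n, hn⟩ := exists_pow_lt_of_lt_one (show 0 < η / (5 * ε) by positivity)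
      (one_half_lt_one (α := ℝ))
    have hpos : (0 : ℝ) < (s n).1 := Nat.cast_pos.2 (hs n).1
    refine ⟨1 / (s n).1, by positivity, fun u hu => ?_⟩
    rw [lt_div_iff₀ hpos, mul_comm] at hu
    have h1 := hclose n u t hu
    have h2 := hγd t n
    have h3 := hγd u n
    have h4 := dist_triangle4 (γ u) (f n u) (f n t) (γ t)
    rw [dist_comm (γ u) (f n u)] at h4
    have h5 : 5 * ε / 2 ^ n < η := by
      rw [lt_div_iff₀ (by positivity), one_div, inv_pow] at hn
      calc 5 * ε / 2 ^ n = (2 ^ n)⁻¹ * (5 * ε) := by ring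
        _ < η := hn
    have h6 : 5 * ε / 2 ^ n = 2 * ε / 2 ^ n + ε / 2 ^ n + 2 * ε / 2 ^ n := by ring
    linarith
  refine ⟨⟨⟨γ, hcont⟩, ?_, ?_⟩, fun t => ?_⟩
  · exact tendsto_nhds_unique (hγ 0) (by simp [hf0])
  · exact tendsto_nhds_unique (hγ 1) (by simp [hf1])
  · have h1 := hγd t 0
    have h2 : dist (f 0 t) x ≤ ε := by
      by_cases ht : t = 1
      · rw [ht, hf1, dist_comm]
        exact hxy.dist_le
      · have := hfloor 0 t ht
        have h0 : ⌊((s 0).1 : ℝ) * t⌋₊ = 0 := Nat.lt_one_iff.1 this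
        simp only [f, h0, (hs 0).2.1, dist_self]
        exact hε.le
    have h3 := dist_triangle_left (γ t) x (f 0 t)
    rw [pow_zero, div_one] at h1
    change dist (γ t) x ≤ 3 * ε
    linarith

/-- **Mazurkiewicz–Moore**: a complete, locally connected metric space is locally path connected. -/
theorem locallyPathConnectedSpace_of_locallyConnectedSpace {X : Type*} [MetricSpace X]
    [CompleteSpace X] [LocallyConnectedSpace X] : LocallyPathConnectedSpace X := by
  refine ⟨fun x => Filter.hasBasis_self.2 fun U hU => ?_⟩
  refine ⟨pathComponentIn U x, ?_, isPathConnected_pathComponentIn (mem_of_mem_nhds hU),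
    pathComponentIn_subset⟩
  obtain ⟨r, hr, hrU⟩ := Metric.mem_nhds_iff.1 hU
  filter_upwards [eventually_linked (show 0 < r / 4 by positivity) x] with y hy
  obtain ⟨γ, hγ⟩ := hy.exists_path (by positivity)
  exact ⟨γ, fun t => hrU (by rw [Metric.mem_ball]; linarith [hγ t])⟩

/-- The pairs of points of `A` with equal image under `f` which bound an interval that contains `t`
and whose interior misses `B`. -/
def collapsingPairs {X : Type*} (f : unitInterval → X) (A B : Set unitInterval)
    (t : unitInterval) : Set (unitInterval × unitInterval) :=
  {p | p.1 ∈ A ∧ p.2 ∈ A ∧ p.1 ≤ t ∧ t ≤ p.2 ∧ f p.1 = f p.2 ∧ ∀ z ∈ B, z ≤ p.1 ∨ p.2 ≤ z}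

theorem isClosed_setOf_mem_collapsingPairs {X : Type*} [TopologicalSpace X] [T2Space X]
    {f : unitInterval → X} (hf : Continuous f) {A : Set unitInterval} (hA : IsClosed A)
    (B : Set unitInterval) :
    IsClosed {q : unitInterval × unitInterval × unitInterval |
      q.2 ∈ collapsingPairs f A B q.1} := by
  have hB : IsClosed {q : unitInterval × unitInterval × unitInterval |
      ∀ z ∈ B, z ≤ q.2.1 ∨ q.2.2 ≤ z} := by
    simp only [Set.ofPred_forall]
    exact isClosed_biInter fun z _ => (isClosed_le continuous_const (by fun_prop)).union
      (isClosed_le (by fun_prop) continuous_const)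
  exact (hA.preimage (by fun_prop : Continuous fun q : unitInterval × unitInterval × unitInterval =>
    q.2.1)).inter ((hA.preimage (by fun_prop)).inter ((isClosed_le (by fun_prop) (by fun_prop)).inter
      ((isClosed_le (by fun_prop) (by fun_prop)).inter ((isClosed_eq (by fun_prop)
        (by fun_prop)).inter hB))))

theorem collapsingPairs_unique {X : Type*} {f : unitInterval → X} {A : Set unitInterval}
    {t : unitInterval} {p p' : unitInterval × unitInterval} (hp : p ∈ collapsingPairs f A A t)
    (hp' : p' ∈ collapsingPairs f A A t) : f p.1 = f p'.1 := by
  obtain ⟨ha, hb, hat, htb, hf, hd⟩ := hp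
  obtain ⟨ha', hb', hat', htb', hf', hd'⟩ := hp'
  by_cases ht : t ∈ A
  · have h1 : f p.1 = f t := (hd t ht).elim (fun h => by rw [le_antisymm hat h])
      fun h => by rw [hf, le_antisymm h htb]
    have h2 : f p'.1 = f t := (hd' t ht).elim (fun h => by rw [le_antisymm hat' h])
      fun h => by rw [hf', le_antisymm h htb']
    rw [h1, h2]
  · have hlt : ∀ {z}, z ∈ A → z ≤ t → z < t := fun {z} hz h =>
      lt_of_le_of_ne h fun h' => ht (h' ▸ hz)
    have hle : p.1 ≤ p'.1 := (hd' _ ha).resolve_right fun h =>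
      ((hlt ha hat).trans_le htb').not_ge h
    have hle' : p'.1 ≤ p.1 := (hd _ ha').resolve_right fun h =>
      ((hlt ha' hat').trans_le htb).not_ge h
    rw [le_antisymm hle hle']

/-- Every loop of a path can be skipped: a path has the same endpoints as some path within its range
all of whose fibres are intervals. -/
theorem exists_monotone_path {X : Type*} [TopologicalSpace X] [T2Space X]
    {f : unitInterval → X} (hf : Continuous f) :
    ∃ g : unitInterval → X, Continuous g ∧ g 0 = f 0 ∧ g 1 = f 1 ∧ Set.range g ⊆ Set.range f ∧
      ∀ s u t, s ≤ u → u ≤ t → g s = g t → g u = g s := by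
  let S : Set (Set unitInterval) :=
    {A | IsClosed A ∧ 0 ∈ A ∧ 1 ∈ A ∧ ∀ t, (collapsingPairs f A A t).Nonempty}
  have hclosed : ∀ {A : Set unitInterval}, IsClosed A → ∀ B t,
      IsClosed (collapsingPairs f A B t) := fun {A} hA B t =>
    (isClosed_setOf_mem_collapsingPairs hf hA B).preimage
      (by fun_prop : Continuous fun p : unitInterval × unitInterval => (t, p))
  obtain ⟨A, -, hA⟩ : ∃ A, A ⊆ Set.univ ∧ Minimal (· ∈ S) A := by
    refine zorn_superset_nonempty S (fun c hcS hc hne => ?_) Set.univ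
      ⟨isClosed_univ, trivial, trivial, fun t => ⟨(t, t), trivial, trivial, le_rfl, le_rfl, rfl,
        fun z _ => le_total z t⟩⟩
    refine ⟨⋂₀ c, ⟨isClosed_sInter fun A hA => (hcS hA).1, fun A hA => (hcS hA).2.1,
      fun A hA => (hcS hA).2.2.1, fun t => ?_⟩, fun A hA => Set.sInter_subset_of_mem hA⟩
    have : Nonempty c := hne.to_subtype
    obtain ⟨p, hp⟩ := IsCompact.nonempty_iInter_of_directed_nonempty_isCompact_isClosed
      (fun A : c => collapsingPairs f A (⋂₀ c) t)
      (fun A B => by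
        have hmono : ∀ {A B : Set unitInterval}, A ⊆ B →
            collapsingPairs f A (⋂₀ c) t ⊆ collapsingPairs f B (⋂₀ c) t :=
          fun h p hp => ⟨h hp.1, h hp.2.1, hp.2.2⟩
        rcases hc.total A.2 B.2 with h | h
        · exact ⟨A, subset_rfl, hmono h⟩
        · exact ⟨B, hmono h, subset_rfl⟩)
      (fun A => by
        obtain ⟨p, h1, h2, h3, h4, h5, h6⟩ := (hcS A.2).2.2.2 t
        exact ⟨p, h1, h2, h3, h4, h5, fun z hz => h6 z (hz A A.2)⟩)
      (fun A => (hclosed (hcS A.2).1 _ t).isCompact) (fun A => hclosed (hcS A.2).1 _ t)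
    rw [Set.mem_iInter] at hp
    obtain ⟨A⟩ := this
    exact ⟨p, fun B hB => (hp ⟨B, hB⟩).1, fun B hB => (hp ⟨B, hB⟩).2.1, (hp A).2.2⟩
  obtain ⟨⟨hAc, hA0, hA1, hAp⟩, hmin⟩ := hA
  have hgap : ∀ s ∈ A, ∀ t ∈ A, s ≤ t → f s = f t → ∀ z ∈ A, z ≤ s ∨ t ≤ z := by
    intro s hs t ht hst hfst z hz
    have hsub : A \ Set.Ioo s t ∈ S := by
      refine ⟨hAc.sdiff isOpen_Ioo, ⟨hA0, fun h => not_lt_bot h.1⟩, ⟨hA1, fun h => not_top_lt h.2⟩,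
        fun u => ?_⟩
      by_cases hu : s ≤ u ∧ u ≤ t
      · exact ⟨(s, t), ⟨hs, fun h => h.1.false⟩, ⟨ht, fun h => h.2.false⟩, hu.1, hu.2, hfst,
          fun z hz => by
            by_contra! h
            exact hz.2 h⟩
      · obtain ⟨p, h1, h2, h3, h4, h5, h6⟩ := hAp u
        refine ⟨p, ⟨h1, fun h => ?_⟩, ⟨h2, fun h => ?_⟩, h3, h4, h5, fun z hz => h6 z hz.1⟩
        · have htu : t < u := by
            by_contra! hut
            exact hu ⟨h.1.le.trans h3, hut⟩
          rcases h6 t ht with h7 | h7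
          · exact h.2.not_ge h7
          · exact (htu.trans_le h4).not_ge h7
        · have hus : u < s := by
            by_contra! hsu
            exact hu ⟨hsu, h4.trans h.2.le⟩
          rcases h6 s hs with h7 | h7
          · exact (h3.trans_lt hus).not_ge h7
          · exact h.1.not_ge h7
    by_contra! h
    exact (hmin hsub Set.sdiff_subset hz).2 h
  choose p hp using hAp
  refine ⟨fun t => f (p t).1, ?_, ?_, ?_, ?_, ?_⟩
  · rw [continuous_iff_isClosed]
    intro Z hZ
    have hpre : (fun t => f (p t).1) ⁻¹' Z = Prod.fst ''
        ({q : unitInterval × unitInterval × unitInterval | q.2 ∈ collapsingPairs f A A q.1} ∩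
          (fun q => f q.2.1) ⁻¹' Z) := by
      ext t
      constructor
      · intro ht
        exact ⟨(t, p t), ⟨hp t, ht⟩, rfl⟩
      · rintro ⟨⟨t, q⟩, ⟨hq, hqZ⟩, rfl⟩
        change f (p t).1 ∈ Z
        rw [collapsingPairs_unique (hp t) hq]
        exact hqZ
    rw [hpre]
    exact (((isClosed_setOf_mem_collapsingPairs hf hAc A).inter
      (hZ.preimage (by fun_prop))).isCompact.image continuous_fst).isClosed
  · exact collapsingPairs_unique (p' := (0, 0)) (hp 0)
      ⟨hA0, hA0, le_rfl, le_rfl, rfl, fun z _ => Or.inr bot_le⟩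
  · exact collapsingPairs_unique (p' := (1, 1)) (hp 1)
      ⟨hA1, hA1, le_rfl, le_rfl, rfl, fun z _ => Or.inl le_top⟩
  · rintro _ ⟨t, rfl⟩
    exact ⟨_, rfl⟩
  · intro s u t hsu hut hst
    obtain ⟨h1, h2, h3, h4, h5, h6⟩ := hp s
    obtain ⟨k1, k2, k3, k4, k5, k6⟩ := hp t
    have hfe : f (p s).1 = f (p t).2 := hst.trans k5
    have hle : (p s).1 ≤ (p t).2 := h3.trans ((hsu.trans hut).trans k4)
    exact collapsingPairs_unique (p' := ((p s).1, (p t).2)) (hp u)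
      ⟨h1, k2, h3.trans hsu, hut.trans k4, hfe, hgap _ h1 _ k2 hle hfe⟩

/-- In a compact metric space, distinct points joined by a path are joined by an arc within
the range of that path. -/
theorem Path.exists_injective {X : Type*} [MetricSpace X] [CompactSpace X] {x y : X} (γ : Path x y)
    (hxy : x ≠ y) : ∃ α : Path x y, Function.Injective α ∧ Set.range α ⊆ Set.range γ := by
  have : Nonempty X := ⟨x⟩
  obtain ⟨g, hg, hg0, hg1, hgr, hgm⟩ := exists_monotone_path γ.continuous
  rw [γ.source] at hg0
  rw [γ.target] at hg1
  let q := TopologicalSpace.denseSeq X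
  let d : ℕ → unitInterval → unitInterval → ℝ := fun k t u => dist (q k) (g (t ⊓ u))
  let h : ℕ → unitInterval → ℝ := fun k t => sInf (d k t '' Set.univ)
  have hdc : ∀ k, Continuous ↿(d k) := fun k => by
    change Continuous fun z : unitInterval × unitInterval => dist (q k) (g (z.1 ⊓ z.2))
    fun_prop
  have hhc : ∀ k, Continuous (h k) := fun k => isCompact_univ.continuous_sInf (hdc k)
  have hbdd : ∀ k t, BddBelow (d k t '' Set.univ) := fun k t =>
    ⟨0, by rintro _ ⟨u, -, rfl⟩; exact dist_nonneg⟩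
  have hh_le : ∀ k {s t}, s ≤ t → h k t ≤ dist (q k) (g s) := fun k {s t} hst =>
    csInf_le (hbdd k t) ⟨s, trivial, by simp [d, inf_eq_right.2 hst]⟩
  have hle_h : ∀ k t r, (∀ s ≤ t, r ≤ dist (q k) (g s)) → r ≤ h k t := fun k t r hr =>
    le_csInf (Set.univ_nonempty.image _) (by rintro _ ⟨u, -, rfl⟩; exact hr _ inf_le_left)
  have hanti : ∀ k {s t}, s ≤ t → h k t ≤ h k s := fun k {s t} hst =>
    hle_h k s _ fun u hu => hh_le k (hu.trans hst)
  have hbound : ∀ k t, ‖(1 / 2 : ℝ) ^ k * h k t‖ ≤ (1 / 2) ^ k * Metric.diam (Set.univ : Set X) := by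
    intro k t
    have h0 : 0 ≤ h k t := hle_h k t 0 fun _ _ => dist_nonneg
    rw [norm_mul, Real.norm_of_nonneg h0, Real.norm_of_nonneg (by positivity)]
    exact mul_le_mul_of_nonneg_left ((hh_le k le_rfl).trans
      (Metric.dist_le_diam_of_mem isCompact_univ.isBounded trivial trivial)) (by positivity)
  have hsummable : Summable fun k : ℕ => (1 / 2 : ℝ) ^ k * Metric.diam (Set.univ : Set X) :=
    summable_geometric_two.mul_right _
  have hsum : ∀ t, Summable fun k => (1 / 2 : ℝ) ^ k * h k t := fun t =>
    Summable.of_norm_bounded hsummable fun k => hbound k t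
  let m : unitInterval → ℝ := fun t => ∑' k, (1 / 2 : ℝ) ^ k * h k t
  have hmc : Continuous m :=
    continuous_tsum (fun k => continuous_const.mul (hhc k)) hsummable hbound
  have hmanti : ∀ {s t}, s ≤ t → m t ≤ m s := fun {s t} hst =>
    (hsum t).tsum_le_tsum (fun k => mul_le_mul_of_nonneg_left (hanti k hst) (by positivity)) (hsum s)
  have hm_of : ∀ s t, s ≤ t → m s = m t → g s = g t := by
    intro s t hst hmst
    have heq : ∀ k, h k s = h k t := by
      intro k
      by_contra hne
      refine hmst.not_gt ((hsum t).tsum_lt_tsum (i := k)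
        (fun k => mul_le_mul_of_nonneg_left (hanti k hst) (by positivity)) ?_ (hsum s))
      exact mul_lt_mul_of_pos_left (lt_of_le_of_ne (hanti k hst) (Ne.symm hne)) (by positivity)
    by_contra hne
    have hnot : g t ∉ g '' Set.Iic s := by
      rintro ⟨u, hu, hut⟩
      have hu' : u ≤ s := hu
      exact hne ((hgm u s t hu' hst hut).trans hut)
    obtain ⟨r, hr, hball⟩ := Metric.isOpen_iff.1
      (isClosed_Iic.isCompact.image hg).isClosed.isOpen_compl _ hnot
    obtain ⟨k, hk⟩ := (TopologicalSpace.denseRange_denseSeq X).exists_dist_lt (g t)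
      (half_pos hr)
    have h1 : h k t ≤ dist (q k) (g t) := hh_le k le_rfl
    have h2 : r / 2 ≤ h k s := by
      refine hle_h k s _ fun u hu => ?_
      by_contra! hlt
      refine hball (a := g u) ?_ ⟨u, hu, rfl⟩
      rw [Metric.mem_ball]
      have := dist_triangle_left (g u) (g t) (q k)
      rw [dist_comm (g t)] at hk
      change dist (q k) (g t) < r / 2 at hk
      linarith
    rw [heq k] at h2
    rw [dist_comm (g t)] at hk
    change dist (q k) (g t) < r / 2 at hk
    linarith
  have hm_iff : ∀ s t, m s = m t ↔ g s = g t := by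
    intro s t
    wlog hst : s ≤ t generalizing s t
    · rw [eq_comm, this t s (le_of_not_ge hst), eq_comm]
    refine ⟨hm_of s t hst, fun hgst => ?_⟩
    have heq : ∀ k, h k s = h k t := fun k =>
      le_antisymm (hle_h k t _ fun u hu => by
        rcases le_total u s with hus | hsu
        · exact hh_le k hus
        · rw [hgm s u t hsu hu hgst]
          exact hh_le k le_rfl) (hanti k hst)
    simp only [m, heq]
  have hm01 : m 1 < m 0 := lt_of_le_of_ne (hmanti bot_le) fun he => by
    rw [hm_iff, hg0, hg1] at he
    exact hxy he.symm
  have hden : 0 < m 0 - m 1 := sub_pos.2 hm01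
  let φ : unitInterval → unitInterval := fun t => ⟨(m 0 - m t) / (m 0 - m 1),
    div_nonneg (sub_nonneg.2 (hmanti bot_le)) hden.le,
    (div_le_one hden).2 (sub_le_sub_left (hmanti le_top) _)⟩
  have hφc : Continuous φ := by
    refine Continuous.subtype_mk ?_ _
    fun_prop
  have hφ0 : φ 0 = 0 := Subtype.ext (by simp [φ])
  have hφ1 : φ 1 = 1 := Subtype.ext (by simp [φ, hden.ne'])
  have hφ_iff : ∀ s t, φ s = φ t ↔ g s = g t := fun s t => by
    rw [← hm_iff, Subtype.ext_iff]
    simp [φ, div_left_inj' hden.ne']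
  have hφs : Function.Surjective φ := fun t =>
    mem_range_of_exists_le_of_exists_ge hφc ⟨0, by rw [hφ0]; exact bot_le⟩
      ⟨1, by rw [hφ1]; exact le_top⟩
  have hq : IsQuotientMap φ := IsQuotientMap.of_surjective_continuous hφs hφc
  choose σ hσ using hφs
  have hσg : ∀ t, g (σ (φ t)) = g t := fun t => (hφ_iff _ _).1 (hσ _)
  have hσc : Continuous (g ∘ σ) := hq.continuous_iff.2 (by
    have : (g ∘ σ) ∘ φ = g := funext hσg
    rwa [this])
  refine ⟨⟨⟨g ∘ σ, hσc⟩, ?_, ?_⟩, fun s t hst => ?_, ?_⟩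
  · change g (σ 0) = x
    rw [← hφ0, hσg, hg0]
  · change g (σ 1) = y
    rw [← hφ1, hσg, hg1]
  · have := (hφ_iff _ _).2 (show g (σ s) = g (σ t) from hst)
    rwa [hσ, hσ] at this
  · rintro _ ⟨t, rfl⟩
    exact hgr ⟨σ t, rfl⟩

theorem exists_isSimpleClosedCurve_of_range_inter_subset {X : Type*} [TopologicalSpace X] [T2Space X]
    {p q : X} {α : Path p q} {β : Path q p} (hα : Function.Injective α)
    (hβ : Function.Injective β) (hαβ : Set.range α ∩ Set.range β ⊆ {p, q}) :
    ∃ S : Set X, IsSimpleClosedCurve S := by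
  have : Fact ((0 : ℝ) < 1) := ⟨one_pos⟩
  have hcross : ∀ s t : unitInterval, α s = β t → t = 0 ∨ t = 1 := fun s t h => by
    rcases hαβ ⟨⟨s, rfl⟩, t, h.symm⟩ with h' | h'
    · exact .inr (hβ (by rw [← h, h', β.target]))
    · exact .inl (hβ (by rw [← h, h', β.source]))
  let γ : ℝ → X := (α.trans β).extend
  have hγ : ∀ t : unitInterval, γ t = if h : (t : ℝ) ≤ 1 / 2 then
      α ⟨2 * t, (unitInterval.mul_pos_mem_iff zero_lt_two).2 ⟨t.2.1, h⟩⟩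
      else β ⟨2 * t - 1, unitInterval.two_mul_sub_one_mem_iff.2 ⟨(not_le.1 h).le, t.2.2⟩⟩ :=
    fun t => ((α.trans β).extend_apply t.2).trans (Path.trans_apply α β t)
  have hlift : Continuous (AddCircle.liftIco 1 0 γ) := by
    refine AddCircle.liftIco_continuous ?_ (α.trans β).continuous_extend.continuousOn
    simp [γ]
  have hmixed : ∀ s t : unitInterval, (s : ℝ) ≤ 1 / 2 → ¬(t : ℝ) ≤ 1 / 2 → (t : ℝ) < 1 →
      γ s ≠ γ t := fun s t hs ht ht1 h => by
    rw [hγ, hγ, dif_pos hs, dif_neg ht] at h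
    rcases hcross _ _ h with h | h <;> have := congrArg Subtype.val h <;> simp at this <;> linarith
  have hinj : Function.Injective (AddCircle.liftIco 1 0 γ) := by
    intro a b hab
    obtain ⟨s, hs, rfl⟩ : ∃ s ∈ Set.Ico (0 : ℝ) 1, (s : AddCircle (1 : ℝ)) = a :=
      ⟨AddCircle.equivIco 1 0 a, by simpa using (AddCircle.equivIco (1 : ℝ) 0 a).2,
        (AddCircle.equivIco 1 0).symm_apply_apply a⟩
    obtain ⟨t, ht, rfl⟩ : ∃ t ∈ Set.Ico (0 : ℝ) 1, (t : AddCircle (1 : ℝ)) = b :=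
      ⟨AddCircle.equivIco 1 0 b, by simpa using (AddCircle.equivIco (1 : ℝ) 0 b).2,
        (AddCircle.equivIco 1 0).symm_apply_apply b⟩
    rw [AddCircle.liftIco_zero_coe_apply hs, AddCircle.liftIco_zero_coe_apply ht] at hab
    lift s to unitInterval using Set.Ico_subset_Icc_self hs
    lift t to unitInterval using Set.Ico_subset_Icc_self ht
    suffices (s : ℝ) = t by rw [this]
    by_cases hs2 : (s : ℝ) ≤ 1 / 2 <;> by_cases ht2 : (t : ℝ) ≤ 1 / 2
    · rw [hγ, hγ, dif_pos hs2, dif_pos ht2] at hab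
      simpa using hα hab
    · exact absurd hab (hmixed s t hs2 ht2 ht.2)
    · exact absurd hab.symm (hmixed t s ht2 hs2 hs.2)
    · rw [hγ, hγ, dif_neg hs2, dif_neg ht2] at hab
      simpa using hβ hab
  exact ⟨_, ⟨(hlift.isClosedEmbedding hinj).isEmbedding.toHomeomorph.symm⟩⟩

/-- If an arc passes through `z` and its endpoints can also be joined by a path avoiding `z`, then
there is a simple closed curve. -/
theorem exists_isSimpleClosedCurve_of_notMem_range {X : Type*} [MetricSpace X] [CompactSpace X]
    {x y : X} {α β : Path x y} (hα : Function.Injective α) {m : unitInterval}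
    (hm : α m ∉ Set.range β) : ∃ S : Set X, IsSimpleClosedCurve S := by
  have hclosed : ∀ s : Set unitInterval, IsClosed s → IsClosed (β ⁻¹' (α '' s)) := fun s hs =>
    (hs.isCompact.image α.continuous).isClosed.preimage β.continuous
  obtain ⟨t₀, ⟨a, ham, hat⟩, ht₀⟩ :=
    (hclosed (Set.Iic m) isClosed_Iic).isCompact.exists_isGreatest
      ⟨0, 0, unitInterval.nonneg', by rw [α.source, β.source]⟩
  have ht₀1 : t₀ ≤ 1 := unitInterval.le_one'
  obtain ⟨t₁, ⟨⟨b, hmb, hbt⟩, h01⟩, ht₁⟩ :=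
    ((hclosed (Set.Ici m) isClosed_Ici).inter isClosed_Ici).isCompact.exists_isLeast
      (⟨1, ⟨1, unitInterval.le_one', by rw [α.target, β.target]⟩, ht₀1⟩ :
        (β ⁻¹' (α '' Set.Ici m) ∩ Set.Ici t₀).Nonempty)
  have ham' : a < m := lt_of_le_of_ne ham fun h => hm ⟨t₀, by rw [← hat, h]⟩
  have hmb' : m < b := lt_of_le_of_ne hmb fun h => hm ⟨t₁, by rw [← hbt, h]⟩
  have hab : α a ≠ α b := fun h => (ham'.trans hmb').ne (hα h)
  obtain ⟨α', hα', hrα⟩ := (α.subpath a b).exists_injective hab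
  obtain ⟨β', hβ', hrβ⟩ := ((β.subpath t₀ t₁).cast hat hbt).symm.exists_injective hab.symm
  refine exists_isSimpleClosedCurve_of_range_inter_subset hα' hβ' ?_
  rintro w ⟨hwα, hwβ⟩
  have hwα := hrα hwα
  have hwβ := hrβ hwβ
  rw [Path.symm_range, Path.cast_coe, Path.range_subpath_of_le _ _ _ h01] at hwβ
  rw [Path.range_subpath_of_le _ _ _ (ham'.trans hmb').le] at hwα
  obtain ⟨s, -, rfl⟩ := hwα
  obtain ⟨t, ht, hts⟩ := hwβ
  rcases le_total s m with hsm | hsm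
  · left
    rw [← hts, hat, le_antisymm (ht₀ ⟨s, hsm, hts.symm⟩) ht.1]
  · right
    rw [← hts, Set.mem_singleton_iff, hbt,
      le_antisymm ht.2 (ht₁ ⟨⟨s, hsm, hts.symm⟩, ht.1⟩)]

theorem IsDendrite.exists_isOpen_frontier_subset_singleton {X : Type*} [MetricSpace X]
    (hX : IsDendrite X) {x y : X} (hxy : x ≠ y) :
    ∃ (z : X) (A : Set X), IsOpen A ∧ x ∈ A ∧ y ∉ closure A ∧ frontier A ⊆ {z} := by
  obtain ⟨⟨-, _, _, -⟩, _, hcircle⟩ := hX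
  have : LocallyPathConnectedSpace X := locallyPathConnectedSpace_of_locallyConnectedSpace
  have : PathConnectedSpace X := .of_locallyPathConnectedSpace
  obtain ⟨α, hα, -⟩ := (PathConnectedSpace.somePath x y).exists_injective hxy
  obtain ⟨m, hm0, hm1⟩ := exists_between (zero_lt_one (α := unitInterval))
  have hxz : x ≠ α m := fun h => hm0.ne (hα (α.source.trans h))
  have hyz : y ≠ α m := fun h => hm1.ne' (hα (α.target.trans h))
  have hopen : ∀ w, IsOpen (connectedComponentIn {α m}ᶜ w) := fun w =>
    isOpen_compl_singleton.connectedComponentIn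
  have hcl : ∀ w ∈ closure (connectedComponentIn {α m}ᶜ x), w ≠ α m →
      w ∈ connectedComponentIn {α m}ᶜ x := fun w hw hwz => by
    obtain ⟨v, hvw, hvx⟩ := mem_closure_iff.1 hw _ (hopen w) (mem_connectedComponentIn hwz)
    rw [connectedComponentIn_eq hvx, ← connectedComponentIn_eq hvw]
    exact mem_connectedComponentIn hwz
  have hyA : y ∉ connectedComponentIn {α m}ᶜ x := fun h => by
    have hconn : IsPathConnected (connectedComponentIn {α m}ᶜ x) :=
      ((hopen x).isConnected_iff_isPathConnected).1 (isConnected_connectedComponentIn_iff.2 hxz)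
    obtain ⟨β, hβ⟩ := hconn.joinedIn x (mem_connectedComponentIn hxz) y h
    obtain ⟨S, hS⟩ := exists_isSimpleClosedCurve_of_notMem_range (β := β) hα (m := m) <| by
      rintro ⟨t, ht⟩
      exact connectedComponentIn_subset _ _ (hβ t) ht
    exact hcircle S hS
  refine ⟨α m, connectedComponentIn {α m}ᶜ x, hopen x, mem_connectedComponentIn hxz,
    fun h => hyA (hcl y h hyz), fun w hw => ?_⟩
  rw [(hopen x).frontier_eq] at hw
  exact by_contra fun h => hw.2 (hcl w hw.1 h)

/-- Every local dendrite is homeomorphic to a subspace of ℝ³. -/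
theorem local_dendrite_embeds_in_R3
    {X : Type u} [TopologicalSpace X] (hX : IsLocalDendrite X) :
    ∃ f : X → EuclideanSpace ℝ (Fin 3), Topology.IsEmbedding f := by
  obtain ⟨⟨-, _, -, _⟩, hN⟩ := hX
  let := TopologicalSpace.metrizableSpaceMetric X
  have hreg : ∀ x : X, ∀ W ∈ 𝓝 x, ∃ V ⊆ W, IsOpen V ∧ x ∈ V ∧ (frontier V).Finite := by
    intro x W hW
    obtain ⟨N, hNx, hN⟩ := hN x
    have : CompactSpace N := hN.1.2.1
    exact exists_isOpen_finite_frontier_of_mem_nhds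
      (isCompact_iff_compactSpace.2 this).isClosed hNx
      (fun y W hW => exists_isOpen_finite_frontier_of_separation
        (fun _ _ => hN.exists_isOpen_frontier_subset_singleton) y hW) hW
  exact exists_isEmbedding_of_covers (n := 2) (by simp)
    fun δ hδ => exists_cover_order_two hreg hδ
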